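/- arXiv:1709.09486 — 14 statements merged into one kernel-verified Lean document; each statement's English description precedes it below -/
import Mathlib

section
/- A reflexive tournament is endo-trivial if and only if it is retract-trivial. -/
/-- `f` is a homomorphism from the digraph with edge relation `E` to the one with
edge relation `F`. -/
def IsDigraphHom {V W : Type*} (E : V → V → Prop) (F : W → W → Prop) (f : V → W) : Prop :=
  ∀ u v, E u v → F (f u) (f v)

/-- `f` is an automorphism of the digraph with edge relation `E`: a bijective
endomorphism whose inverse is also a homomorphism. -/
def IsDigraphAuto {V : Type*} (E : V → V → Prop) (f : V → V) : Prop :=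
  IsDigraphHom E E f ∧
    ∃ g : V → V, (∀ x, g (f x) = x) ∧ (∀ x, f (g x) = x) ∧ IsDigraphHom E E g

/-- `f` is a constant map. -/
def IsConstMap {V : Type*} (f : V → V) : Prop := ∃ c, ∀ x, f x = c

/-- Every endomorphism is an automorphism or a constant map. -/
def EndoTrivial {V : Type*} (E : V → V → Prop) : Prop :=
  ∀ f : V → V, IsDigraphHom E E f → IsDigraphAuto E f ∨ IsConstMap f

/-- `r` is a retraction: an endomorphism that is the identity on its image. -/
def IsRetraction {V : Type*} (E : V → V → Prop) (r : V → V) : Prop :=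
  IsDigraphHom E E r ∧ ∀ x, r (r x) = r x

/-- Every retraction is the identity or a constant map. -/
def RetractTrivial {V : Type*} (E : V → V → Prop) : Prop :=
  ∀ r : V → V, IsRetraction E r → r = id ∨ IsConstMap r

/-- In a reflexive tournament, edges between points can be pulled back along an endomorphism,
provided that the points coincide as soon as their images do. -/
theorem IsDigraphHom.reflect_edge {V : Type*} {E : V → V → Prop} {f : V → V}
    (hf : IsDigraphHom E E f) (hrefl : ∀ v, E v v)
    (htour : ∀ u v : V, u ≠ v → (E u v ↔ ¬ E v u)) {a b : V}
    (hinj : f a = f b → a = b) (hab : E (f a) (f b)) : E a b := by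
  by_cases h : a = b
  · exact h ▸ hrefl a
  · exact (htour a b h).2 fun hba => (htour _ _ (mt hinj h)).1 hab (hf b a hba)

/-- A reflexive tournament is endo-trivial if and only if it is retract-trivial. -/
theorem stmt2 {V : Type*} [Fintype V] [Nontrivial V] (E : V → V → Prop)
    (hrefl : ∀ v, E v v)
    (htour : ∀ u v : V, u ≠ v → (E u v ↔ ¬ E v u)) :
    EndoTrivial E ↔ RetractTrivial E := by
  constructor
  · rintro h r ⟨hr, hidem⟩
    refine (h r hr).imp_left ?_
    rintro ⟨-, g, hg, -⟩
    exact funext fun x => (Function.LeftInverse.injective hg) (hidem x)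
  · intro h f hf
    obtain ⟨s, hs⟩ : ∃ s : V → V, ∀ x, f (s (f x)) = f x :=
      ⟨Function.invFun f, fun x => Function.invFun_eq ⟨x, rfl⟩⟩
    have hret : IsRetraction E fun x => s (f x) := by
      refine ⟨fun u v huv => hf.reflect_edge hrefl htour ?_ ?_, fun x => congrArg s (hs x)⟩
      · rw [hs, hs]
        exact congrArg s
      · rw [hs, hs]
        exact hf u v huv
    rcases h _ hret with hid | ⟨c, hc⟩
    · left
      have hleft : Function.LeftInverse s f := congrFun hid
      have hright : Function.RightInverse s f :=
        hleft.rightInverse_of_surjective (Finite.surjective_of_injective hleft.injective)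
      refine ⟨hf, s, hleft, hright, fun u v huv =>
        hf.reflect_edge hrefl htour (fun e => hleft.injective e) ?_⟩
      rwa [hright, hright]
    · exact Or.inr ⟨f c, fun x => by rw [← hc x, hs]⟩
end

section
/- Let H be a retract-trivial reflexive digraph with at least three vertices. Then H has no double edge: there are no distinct vertices u, v with both (u,v) ∈ E(H) and (v,u) ∈ E(H). -/
/-- A retract-trivial reflexive digraph with at least three vertices has no double edge. -/
theorem stmt3 {V : Type*} [Fintype V] (E : V → V → Prop)
    (hcard : 3 ≤ Fintype.card V)
    (hrefl : ∀ v, E v v)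
    (hrt : RetractTrivial E) :
    ¬ ∃ u v : V, u ≠ v ∧ E u v ∧ E v u := by
  classical
  rintro ⟨u, v, huv, h₁, h₂⟩
  obtain ⟨w, hw⟩ : ∃ w, w ∉ ({u, v} : Finset V) := by
    by_contra! h
    have hle : Fintype.card V ≤ ({u, v} : Finset V).card :=
      Finset.card_le_card fun x _ => h x
    have := Finset.card_le_two (a := u) (b := v)
    omega
  obtain ⟨hwu, hwv⟩ : w ≠ u ∧ w ≠ v := by simpa using hw
  have hr : IsRetraction E (fun x => if x = u then u else v) := by
    refine ⟨fun x y _ => ?_, fun x => ?_⟩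
    · dsimp only
      split_ifs <;> first | assumption | apply hrefl
    · dsimp only
      split_ifs <;> simp_all
  rcases hrt _ hr with h | ⟨c, hc⟩
  · have hvw := congrFun h w
    simp only [if_neg hwu, id] at hvw
    exact hwv hvw.symm
  · have hu := hc u
    have hv := hc v
    simp only [if_true, if_neg huv.symm] at hu hv
    exact huv (hu.trans hv.symm)
end

section
/- Let H be a retract-trivial reflexive digraph with at least three vertices. Then H is strongly connected: for all vertices u, v there is a directed path from u to v. -/
/-- In a retract-trivial digraph with at least three vertices, no map that sends a set `S`
to a vertex `p ∈ S` and its complement to a vertex `q ∉ S` is an endomorphism. -/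
theorem RetractTrivial.not_isDigraphHom_ite {V : Type*} [Fintype V] {E : V → V → Prop}
    (hcard : 3 ≤ Fintype.card V) (hrt : RetractTrivial E) {S : Set V} [DecidablePred (· ∈ S)]
    {p q : V} (hp : p ∈ S) (hq : q ∉ S) :
    ¬ IsDigraphHom E E (fun x => if x ∈ S then p else q) := by
  classical
  intro hom
  have idem : ∀ x, (if (if x ∈ S then p else q) ∈ S then p else q) =
      if x ∈ S then p else q := by
    intro x
    by_cases hx : x ∈ S <;> simp [hx, hp, hq]
  rcases hrt _ ⟨hom, idem⟩ with h | ⟨c, h⟩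
  · have hsub : (Finset.univ : Finset V) ⊆ {p, q} := by
      intro x _
      have hx := congrFun h x
      by_cases hxS : x ∈ S <;> simp_all
    have := (Finset.card_le_card hsub).trans Finset.card_le_two
    rw [Finset.card_univ] at this
    omega
  · have h1 := h p
    have h2 := h q
    simp only [hp, hq, if_true, if_false] at h1 h2
    exact hq (h2.trans h1.symm ▸ hp)

/-- In a retract-trivial reflexive digraph with at least three vertices, the head of every
edge reaches its tail. -/
theorem RetractTrivial.reflTransGen_of_adj {V : Type*} [Fintype V] {E : V → V → Prop}
    (hcard : 3 ≤ Fintype.card V) (hrefl : ∀ v, E v v) (hrt : RetractTrivial E) {u v : V}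
    (huv : E u v) : Relation.ReflTransGen E v u := by
  classical
  by_contra hvu
  refine hrt.not_isDigraphHom_ite hcard (S := {x | Relation.ReflTransGen E v x})
    (p := v) (q := u) .refl hvu fun x y hxy => ?_
  by_cases hx : Relation.ReflTransGen E v x
  · simp [hx, hx.tail hxy, hrefl]
  · by_cases hy : Relation.ReflTransGen E v y <;> simp [hx, hy, hrefl, huv]

/-- A retract-trivial reflexive digraph with at least three vertices is strongly
connected: any vertex reaches any other by a directed path. -/
theorem stmt4 {V : Type*} [Fintype V] (E : V → V → Prop)
    (hcard : 3 ≤ Fintype.card V)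
    (hrefl : ∀ v, E v v)
    (hrt : RetractTrivial E) :
    ∀ u v : V, Relation.ReflTransGen E u v := by
  classical
  intro u v
  by_contra huv
  refine hrt.not_isDigraphHom_ite hcard (S := {x | Relation.ReflTransGen E u x})
    (p := u) (q := v) .refl huv fun x y hxy => ?_
  have hiff : Relation.ReflTransGen E u x ↔ Relation.ReflTransGen E u y :=
    ⟨fun h => h.tail hxy, fun h => h.trans (hrt.reflTransGen_of_adj hcard hrefl hxy)⟩
  by_cases hy : Relation.ReflTransGen E u y <;> simp [hiff, hy, hrefl]
end

section
/- Let H be a retract-trivial reflexive digraph with at least three vertices. Then the automorphisms of H are isolated vertices of the endomorphism digraph Ĥ^H: if σ is an automorphism of H and f is an endomorphism of H with f ≠ σ, then neither (σ,f) nor (f,σ) is an edge of Ĥ^H. -/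
/-- Adjacency in the self-map digraph `G^G`. -/
def SelfMapAdj {V : Type*} (E : V → V → Prop) (f g : V → V) : Prop :=
  ∀ x y, E x y → E (f x) (g y)

open Function

/-- A self-map of a finite type has an idempotent positive iterate. -/
theorem exists_iterate_idempotent {V : Type*} [Finite V] (f : V → V) :
    ∃ n, 0 < n ∧ ∀ x, f^[n] (f^[n] x) = f^[n] x := by
  obtain ⟨a, b, hab, h⟩ := Finite.exists_ne_map_eq_of_infinite fun n : ℕ => f^[n]
  wlog hlt : a < b generalizing a b
  · exact this b a hab.symm h.symm (by omega)
  obtain ⟨p, rfl⟩ := Nat.exists_eq_add_of_lt hlt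
  have step : ∀ m, a ≤ m → f^[m + (p + 1)] = f^[m] := by
    intro m hm
    obtain ⟨k, rfl⟩ := Nat.exists_eq_add_of_le hm
    have e : a + k + (p + 1) = k + (a + p + 1) := by omega
    rw [e, iterate_add, ← show f^[a] = f^[a + p + 1] from h, ← iterate_add, Nat.add_comm]
  have steps : ∀ k m, a ≤ m → f^[m + k * (p + 1)] = f^[m] := by
    intro k
    induction k with
    | zero => simp
    | succ k ih =>
      intro m hm
      rw [Nat.succ_mul, ← Nat.add_assoc, step _ (by omega), ih m hm]
  refine ⟨(a + 1) * (p + 1), by positivity, fun x => ?_⟩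
  rw [← iterate_add_apply, steps _ _ (by nlinarith)]

theorem SelfMapAdj.iterate_right {V : Type*} {E : V → V → Prop} {f : V → V}
    (h : SelfMapAdj E id f) (n : ℕ) : SelfMapAdj E id f^[n] := by
  induction n with
  | zero => exact fun x y hxy => hxy
  | succ n ih => exact fun x y hxy => ih _ _ (h _ _ hxy)

/-- A retract-trivial reflexive digraph on at least three vertices has no vertex dominated
by all vertices. -/
theorem RetractTrivial.not_forall_adj {V : Type*} [Fintype V] {E : V → V → Prop}
    (hcard : 3 ≤ Fintype.card V) (hrefl : ∀ v, E v v) (hrt : RetractTrivial E) (c : V) :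
    ¬ ∀ x, E x c := by
  classical
  intro hc
  obtain ⟨x, hxc, hx⟩ : ∃ x, x ≠ c ∧ ∀ y, y ≠ c → E c y → E c x := by
    by_cases h : ∃ x, x ≠ c ∧ E c x
    · obtain ⟨x, hxc, hx⟩ := h
      exact ⟨x, hxc, fun _ _ _ => hx⟩
    · have : Nontrivial V := Fintype.one_lt_card_iff_nontrivial.mp (by omega)
      obtain ⟨x, hxc⟩ := exists_ne c
      exact ⟨x, hxc, fun y hy hcy => absurd ⟨y, hy, hcy⟩ h⟩
  obtain ⟨z, hz⟩ : ∃ z, z ∉ ({x, c} : Finset V) :=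
    Finset.exists_mem_notMem_of_card_lt_card (s := {x, c}) (t := Finset.univ)
      (Finset.card_le_two.trans_lt (by rw [Finset.card_univ]; omega)) |>.imp fun _ h => h.2
  simp only [Finset.mem_insert, Finset.mem_singleton, not_or] at hz
  have hr : IsRetraction E (fun v => if v = c then c else x) := by
    refine ⟨?_, ?_⟩
    · intro u v huv
      by_cases hu : u = c <;> by_cases hv : v = c <;> simp only [hu, hv, if_true, if_false]
      · exact hrefl c
      · exact hx v hv (hu ▸ huv)
      · exact hc x
      · exact hrefl x
    · intro v
      by_cases hv : v = c <;> simp [hv, hxc]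
  rcases hrt _ hr with h | ⟨d, hd⟩
  · have := congrFun h z
    simp only [hz.2, if_false, id] at this
    exact hz.1 this.symm
  · have h1 := hd c
    have h2 := hd x
    simp only [if_true, hxc, if_false] at h1 h2
    exact hxc (h2.trans h1.symm)

/-- In a retract-trivial digraph on at least three vertices, no vertex dominates another one
in both neighbourhoods. -/
theorem RetractTrivial.eq_of_dominated {V : Type*} [Fintype V] {E : V → V → Prop}
    (hcard : 3 ≤ Fintype.card V) (hrt : RetractTrivial E) {a b : V}
    (hin : ∀ u, E u a → E u b) (hout : ∀ v, E a v → E b v) : a = b := by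
  classical
  by_contra hab
  obtain ⟨z, hz⟩ : ∃ z, z ∉ ({a, b} : Finset V) :=
    Finset.exists_mem_notMem_of_card_lt_card (s := {a, b}) (t := Finset.univ)
      (Finset.card_le_two.trans_lt (by rw [Finset.card_univ]; omega)) |>.imp fun _ h => h.2
  simp only [Finset.mem_insert, Finset.mem_singleton, not_or] at hz
  have hba : b ≠ a := Ne.symm hab
  have hr : IsRetraction E (fun v => if v = a then b else v) := by
    refine ⟨?_, ?_⟩
    · intro u v huv
      by_cases hu : u = a <;> by_cases hv : v = a <;> simp only [hu, hv, if_true, if_false]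
      · exact hout _ (hin _ (by simpa [hu, hv] using huv))
      · exact hout _ (hu ▸ huv)
      · exact hin _ (hv ▸ huv)
      · exact huv
    · intro v
      by_cases hv : v = a <;> simp [hv, hba]
  rcases hrt _ hr with h | ⟨d, hd⟩
  · have := congrFun h a
    simp only [if_true, id] at this
    exact hba this
  · have h1 := hd b
    have h2 := hd z
    simp only [hba, hz.1, if_false] at h1 h2
    exact hz.2 (h2.trans h1.symm)

theorem RetractTrivial.eq_id_of_selfMapAdj_id {V : Type*} [Fintype V] {E : V → V → Prop}
    (hcard : 3 ≤ Fintype.card V) (hrefl : ∀ v, E v v) (hrt : RetractTrivial E)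
    {f : V → V} (hf : IsDigraphHom E E f) (h : SelfMapAdj E id f) : f = id := by
  have hom : ∀ n, IsDigraphHom E E f^[n] := by
    intro n
    induction n with
    | zero => exact fun u v huv => huv
    | succ n ih => exact fun u v huv => ih _ _ (hf _ _ huv)
  obtain ⟨n, hn, hidem⟩ := exists_iterate_idempotent f
  rcases hrt f^[n] ⟨hom n, hidem⟩ with hid | ⟨c, hc⟩
  · obtain ⟨m, rfl⟩ := Nat.exists_eq_succ_of_ne_zero hn.ne'
    have hl : ∀ x, f^[m] (f x) = x := congrFun hid
    have hr : ∀ x, f (f^[m] x) = x := fun x => by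
      rw [← iterate_succ_apply' f m x]
      exact congrFun hid x
    funext y
    refine hrt.eq_of_dominated hcard (fun u hu => ?_) fun v hv => ?_
    · simpa only [hl, id] using h.iterate_right m _ _ hu
    · have := h _ _ (hom m _ _ hv)
      simpa only [hl, hr, id] using this
  · refine (hrt.not_forall_adj hcard hrefl c fun x => ?_).elim
    simpa only [hc, id] using h.iterate_right n _ _ (hrefl x)

theorem RetractTrivial.flip {V : Type*} {E : V → V → Prop} (hrt : RetractTrivial E) :
    RetractTrivial fun u v => E v u :=
  fun r hr => hrt r ⟨fun u v huv => hr.1 v u huv, hr.2⟩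

theorem IsDigraphAuto.flip {V : Type*} {E : V → V → Prop} {σ : V → V}
    (hσ : IsDigraphAuto E σ) : IsDigraphAuto (fun u v => E v u) σ := by
  obtain ⟨h, g, hl, hr, hg⟩ := hσ
  exact ⟨fun u v huv => h v u huv, g, hl, hr, fun u v huv => hg v u huv⟩

theorem RetractTrivial.eq_of_selfMapAdj {V : Type*} [Fintype V] {E : V → V → Prop}
    (hcard : 3 ≤ Fintype.card V) (hrefl : ∀ v, E v v) (hrt : RetractTrivial E)
    {σ f : V → V} (hσ : IsDigraphAuto E σ) (hf : IsDigraphHom E E f)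
    (h : SelfMapAdj E σ f) : f = σ := by
  obtain ⟨-, g, hl, hr, hg⟩ := hσ
  have key : g ∘ f = id :=
    hrt.eq_id_of_selfMapAdj_id hcard hrefl (fun u v huv => hg _ _ (hf _ _ huv)) fun x y hxy => by
      simpa only [hl, id, comp_apply] using hg _ _ (h _ _ hxy)
  funext x
  rw [← hr (f x), ← comp_apply (f := g), key, id]

/-- In a retract-trivial reflexive digraph with at least three vertices, the automorphisms
are isolated vertices of the endomorphism digraph `Ĥ^H`. -/
theorem stmt5 {V : Type*} [Fintype V] (E : V → V → Prop)
    (hcard : 3 ≤ Fintype.card V)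
    (hrefl : ∀ v, E v v)
    (hrt : RetractTrivial E)
    (σ f : V → V) (hσ : IsDigraphAuto E σ) (hf : IsDigraphHom E E f) (hne : f ≠ σ) :
    ¬ SelfMapAdj E σ f ∧ ¬ SelfMapAdj E f σ := by
  exact ⟨fun h => hne (hrt.eq_of_selfMapAdj hcard hrefl hσ hf h),
    fun h => hne (RetractTrivial.eq_of_selfMapAdj (E := fun u v => E v u) hcard hrefl hrt.flip
      hσ.flip (fun u v huv => hf v u huv) fun x y hxy => h y x hxy)⟩
end

section
/- Let H be an endo-trivial reflexive digraph with at least three vertices. Then every polymorphism of H, of every arity k ≥ 1, is essentially unary. -/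
/-- A `k`-ary polymorphism of the digraph with edge relation `E`. -/
def IsPolymorphism {V : Type*} (E : V → V → Prop) {k : ℕ} (f : (Fin k → V) → V) : Prop :=
  ∀ x y : Fin k → V, (∀ i, E (x i) (y i)) → E (f x) (f y)

open Function

theorem EndoTrivial.injective_or_const {V : Type*} {E : V → V → Prop} (het : EndoTrivial E)
    {f : V → V} (hf : IsDigraphHom E E f) : Injective f ∨ ∀ x y, f x = f y := by
  rcases het f hf with ⟨-, g, hg, -⟩ | ⟨c, hc⟩
  · exact Or.inl (LeftInverse.injective hg)
  · exact Or.inr fun x y => (hc x).trans (hc y).symm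

theorem EndoTrivial.flip {V : Type*} {E : V → V → Prop} (het : EndoTrivial E) :
    EndoTrivial (flip E) := fun f hf => by
  rcases het f fun u v h => hf v u h with ⟨-, g, h₁, h₂, hg⟩ | hc
  · exact Or.inl ⟨hf, g, h₁, h₂, fun u v h => hg v u h⟩
  · exact Or.inr hc

/-- An endomorphism of an endo-trivial digraph on at least three vertices that takes at most
two values is constant. -/
theorem EndoTrivial.const_of_two_valued {V : Type*} [Fintype V] {E : V → V → Prop}
    (het : EndoTrivial E) (hcard : 3 ≤ Fintype.card V) {f : V → V} (hf : IsDigraphHom E E f)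
    (a b : V) (hab : ∀ x, f x = a ∨ f x = b) (x y : V) : f x = f y := by
  classical
  refine (het.injective_or_const hf).elim (fun hinj => ?_) fun h => h x y
  have hsub : Finset.univ.image f ⊆ {a, b} := by
    intro z hz
    obtain ⟨w, -, rfl⟩ := Finset.mem_image.mp hz
    simpa using hab w
  have h₁ := Finset.card_le_card hsub
  rw [Finset.card_image_of_injective _ hinj, Finset.card_univ] at h₁
  have h₂ : ({a, b} : Finset V).card ≤ 2 := Finset.card_le_two
  omega

/-- An endo-trivial reflexive digraph on at least three vertices is weakly connected. -/
theorem EndoTrivial.connected {V : Type*} [Fintype V] {E : V → V → Prop}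
    (het : EndoTrivial E) (hcard : 3 ≤ Fintype.card V) (hrefl : ∀ v, E v v)
    (P : V → Prop) (hP : ∀ u v, E u v → (P u ↔ P v)) (u v : V) : P u ↔ P v := by
  classical
  suffices h : ∀ u v, P u → P v from ⟨h u v, h v u⟩
  intro u v hu
  by_contra hv
  have hf : IsDigraphHom E E fun x => if P x then u else v := by
    intro x y hxy
    have := hP x y hxy
    by_cases hx : P x <;> simp_all
  have huv := het.const_of_two_valued hcard hf u v
    (fun x => by by_cases hx : P x <;> simp [hx]) u v
  simp only [hu, hv, if_true, if_false] at huv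
  exact hv (huv ▸ hu)

/-- An endo-trivial reflexive digraph on at least three vertices has no universal sink. -/
theorem EndoTrivial.not_universal_sink {V : Type*} [Fintype V] {E : V → V → Prop}
    (het : EndoTrivial E) (hcard : 3 ≤ Fintype.card V) (hrefl : ∀ v, E v v) (c : V) :
    ¬ ∀ v, E v c := by
  classical
  intro hc
  by_cases h : ∃ w, w ≠ c ∧ E c w
  · obtain ⟨w, hwc, hw⟩ := h
    have hf : IsDigraphHom E E fun x => if x = w then w else c := by
      intro x y _
      by_cases hx : x = w <;> by_cases hy : y = w <;> simp [hx, hy, hrefl, hc, hw]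
    have := het.const_of_two_valued hcard hf w c
      (fun x => by by_cases hx : x = w <;> simp [hx]) w c
    simp [hwc.symm] at this
    exact hwc this
  · push Not at h
    have : Nontrivial V := Fintype.one_lt_card_iff_nontrivial.mp (by omega)
    obtain ⟨w, hwc⟩ := exists_ne c
    have hf : IsDigraphHom E E fun x => if x = c then c else w := by
      intro x y hxy
      by_cases hx : x = c
      · subst hx
        by_cases hy : y = x
        · simp [hy, hrefl]
        · exact absurd hxy (h y hy)
      · by_cases hy : y = c <;> simp [hx, hy, hrefl, hc]
    have := het.const_of_two_valued hcard hf c w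
      (fun x => by by_cases hx : x = c <;> simp [hx]) w c
    simp [hwc] at this

theorem EndoTrivial.injective_of_adj {V : Type*} [Fintype V] {E : V → V → Prop}
    (het : EndoTrivial E) (hcard : 3 ≤ Fintype.card V) (hrefl : ∀ v, E v v)
    {σ τ : V → V} (hτ : IsDigraphHom E E τ) (h : ∀ x, E (σ x) (τ x))
    (hinj : Injective σ) : Injective τ := by
  refine (het.injective_or_const hτ).resolve_right fun hconst => ?_
  have : Nonempty V := Fintype.card_pos_iff.mp (by omega)
  obtain ⟨a⟩ := this
  refine het.not_universal_sink hcard hrefl (τ a) fun v => ?_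
  obtain ⟨x, rfl⟩ := Finite.surjective_of_injective hinj v
  exact hconst x a ▸ h x

theorem EndoTrivial.injective_iff_of_adj {V : Type*} [Fintype V] {E : V → V → Prop}
    (het : EndoTrivial E) (hcard : 3 ≤ Fintype.card V) (hrefl : ∀ v, E v v)
    {σ τ : V → V} (hσ : IsDigraphHom E E σ) (hτ : IsDigraphHom E E τ)
    (h : ∀ x, E (σ x) (τ x)) : Injective σ ↔ Injective τ :=
  ⟨het.injective_of_adj hcard hrefl hτ h,
    het.flip.injective_of_adj hcard hrefl (fun u v huv => hσ v u huv) h⟩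

/-- A binary relation on a finite set that is preserved by a quasigroup operation is
rectangular. -/
theorem rectangular_of_quasigroup {V : Type*} [Finite V] {E : V → V → Prop} {m : V → V → V}
    (hm : ∀ x x' y y', E x x' → E y y' → E (m x y) (m x' y'))
    (hl : ∀ a, Injective (m a)) (hr : ∀ b, Injective fun a => m a b)
    {x y z w : V} (hxz : E x z) (hxy : E x y) (hwy : E w y) : E w z := by
  have divl : ∀ a a' c c', E a a' → E c c' → ∃ b b', E b b' ∧ m a b = c ∧ m a' b' = c' := by
    intro a a' c c' ha hc
    let φ : {p : V × V // E p.1 p.2} → {p : V × V // E p.1 p.2} :=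
      fun p => ⟨(m a p.1.1, m a' p.1.2), hm _ _ _ _ ha p.2⟩
    have hφ : Injective φ := by
      rintro ⟨⟨p, p'⟩, hp⟩ ⟨⟨q, q'⟩, hq⟩ h
      simp only [φ, Subtype.mk.injEq, Prod.mk.injEq] at h
      simp [hl a h.1, hl a' h.2]
    obtain ⟨⟨⟨b, b'⟩, hb⟩, h⟩ := Finite.surjective_of_injective hφ ⟨(c, c'), hc⟩
    simp only [φ, Subtype.mk.injEq, Prod.mk.injEq] at h
    exact ⟨b, b', hb, h⟩
  have divr : ∀ b b' c c', E b b' → E c c' → ∃ a a', E a a' ∧ m a b = c ∧ m a' b' = c' := by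
    intro b b' c c' hb hc
    let φ : {p : V × V // E p.1 p.2} → {p : V × V // E p.1 p.2} :=
      fun p => ⟨(m p.1.1 b, m p.1.2 b'), hm _ _ _ _ p.2 hb⟩
    have hφ : Injective φ := by
      rintro ⟨⟨p, p'⟩, hp⟩ ⟨⟨q, q'⟩, hq⟩ h
      simp only [φ, Subtype.mk.injEq, Prod.mk.injEq] at h
      simp [hr b h.1, hr b' h.2]
    obtain ⟨⟨⟨a, a'⟩, ha⟩, h⟩ := Finite.surjective_of_injective hφ ⟨(c, c'), hc⟩
    simp only [φ, Subtype.mk.injEq, Prod.mk.injEq] at h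
    exact ⟨a, a', ha, h⟩
  obtain ⟨e, e', he, h₁, h₂⟩ := divl x y x y hxy hxy
  obtain ⟨s, s', hs, h₃, h₄⟩ := divr e e' x z he hxz
  obtain ⟨t, t', ht, h₅, h₆⟩ := divl x y w y hxy hwy
  obtain rfl : s = x := hr e (h₃.trans h₁.symm)
  obtain rfl : t' = e' := hl y (h₆.trans h₂.symm)
  have := hm _ _ _ _ hs ht
  rwa [h₅, h₄] at this

theorem EndoTrivial.not_quasigroup {V : Type*} [Fintype V] {E : V → V → Prop}
    (het : EndoTrivial E) (hcard : 3 ≤ Fintype.card V) (hrefl : ∀ v, E v v) {m : V → V → V}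
    (hm : ∀ x x' y y', E x x' → E y y' → E (m x y) (m x' y'))
    (hl : ∀ a, Injective (m a)) (hr : ∀ b, Injective fun a => m a b) : False := by
  classical
  have htrans : ∀ {x y z}, E x y → E y z → E x z := fun hxy hyz =>
    rectangular_of_quasigroup hm hl hr hyz (hrefl _) hxy
  have hsymm : ∀ {x y}, E x y → E y x := fun hxy =>
    rectangular_of_quasigroup hm hl hr (hrefl _) hxy (hrefl _)
  have htotal : ∀ x y, E x y := fun x y =>
    (het.connected hcard hrefl (E x)
      (fun u v huv => ⟨fun h => htrans h huv, fun h => htrans h (hsymm huv)⟩) x y).mp (hrefl x)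
  have : Nontrivial V := Fintype.one_lt_card_iff_nontrivial.mp (by omega)
  obtain ⟨a, b, hab⟩ := exists_pair_ne V
  have := het.const_of_two_valued hcard (f := fun x => if x = a then a else b)
    (fun _ _ _ => htotal _ _) a b (fun x => by by_cases hx : x = a <;> simp [hx]) a b
  simp [hab.symm] at this
  exact hab this

/-- A function on a finite power that is invariant under changing any single coordinate
is constant. -/
theorem eq_of_forall_update_eq {ι V β : Type*} [Finite ι] [DecidableEq ι] {F : (ι → V) → β}
    (hF : ∀ a j v, F (update a j v) = F a) (a b : ι → V) : F a = F b := by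
  have := Fintype.ofFinite ι
  have key : ∀ s : Finset ι, F (s.piecewise b a) = F a := by
    intro s
    induction s using Finset.induction_on with
    | empty => simp
    | insert j s _ ih => rw [Finset.piecewise_insert, hF, ih]
  simpa using (key Finset.univ).symm

/-- Every polymorphism of an endo-trivial reflexive digraph with at least three vertices
is essentially unary. -/
theorem stmt6 {V : Type*} [Fintype V] (E : V → V → Prop)
    (hcard : 3 ≤ Fintype.card V)
    (hrefl : ∀ v, E v v)
    (het : EndoTrivial E)
    (k : ℕ) (hk : 1 ≤ k)
    (f : (Fin k → V) → V) (hpoly : IsPolymorphism E f) :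
    ∃ (i : Fin k) (g : V → V), ∀ x : Fin k → V, f x = g (x i) := by
  classical
  have hupd : ∀ {x y : Fin k → V} {i : Fin k} {u v : V}, (∀ j, E (x j) (y j)) → E u v →
      ∀ j, E (update x i u j) (update y i v j) := by
    intro x y i u v hxy huv j
    by_cases hj : j = i
    · subst hj; simpa using huv
    · simpa [hj] using hxy j
  have hline : ∀ (i : Fin k) (a : Fin k → V), IsDigraphHom E E fun x => f (update a i x) :=
    fun i a u v huv => hpoly _ _ (hupd (fun j => hrefl _) huv)
  have hinv : ∀ (i : Fin k) (a b : Fin k → V), Injective (fun x => f (update a i x)) =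
      Injective (fun x => f (update b i x)) := by
    intro i
    refine eq_of_forall_update_eq (F := fun a => Injective fun x => f (update a i x)) ?_
    intro a j v
    have := het.connected hcard hrefl
      (fun w => Injective fun x => f (update (update a j w) i x))
      (fun u w huw => het.injective_iff_of_adj hcard hrefl (hline _ _) (hline _ _)
        fun x => hpoly _ _ (hupd (hupd (fun j => hrefl _) huw) (hrefl x))) v (a j)
    simpa using propext this
  have hunique : ∀ (i j : Fin k) (a b : Fin k → V), i ≠ j →
      Injective (fun x => f (update a i x)) → ¬ Injective (fun x => f (update b j x)) := by
    intro i j a b hij hi hj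
    refine het.not_quasigroup hcard hrefl (m := fun x y => f (update (update a i x) j y))
      (fun x x' y y' hx hy => hpoly _ _ (hupd (hupd (fun _ => hrefl _) hx) hy))
      (fun x => (hinv j _ _).mp hj) fun y => ?_
    simp only [update_comm hij]
    exact (hinv i _ _).mp hi
  have hi : ∃ i : Fin k, ∀ j, j ≠ i → ∀ a, ¬ Injective (fun x => f (update a j x)) := by
    by_cases h : ∃ (i : Fin k) (a : Fin k → V), Injective (fun x => f (update a i x))
    · obtain ⟨i, a, hi⟩ := h
      exact ⟨i, fun j hj b => hunique i j a b hj.symm hi⟩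
    · push Not at h
      exact ⟨⟨0, hk⟩, fun j _ a => h j a⟩
  obtain ⟨i, hi⟩ := hi
  have hne : Nonempty V := Fintype.card_pos_iff.mp (by omega)
  obtain ⟨c⟩ := hne
  refine ⟨i, fun v => f (update (fun _ => c) i v), fun x => ?_⟩
  have := eq_of_forall_update_eq (F := fun a => f (update a i (x i))) (fun a j v => by
    by_cases hj : j = i
    · subst hj; simp
    · have := ((het.injective_or_const (hline j (update a i (x i)))).resolve_left (hi j hj _))
        v (update a i (x i) j)
      rw [update_comm hj]
      simpa only [update_eq_self] using this) x fun _ => c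
  simpa using this
end

section
/- Let H be an endo-trivial reflexive digraph with at least three vertices. Then the endomorphism digraph Ĥ^H is the disjoint union of a copy of H on the constant maps and isolated vertices on the automorphisms: (i) for vertices u, v of H, the pair of constant maps (c_u, c_v) is an edge of Ĥ^H if and only if (u,v) ∈ E(H); (ii) every edge of Ĥ^H between two distinct endomorphisms joins two constant maps. -/
theorem IsDigraphAuto.injective {V : Type*} {E : V → V → Prop} {f : V → V}
    (hf : IsDigraphAuto E f) : Function.Injective f := by
  obtain ⟨-, g, hg, -⟩ := hf
  exact Function.LeftInverse.injective hg

open Classical in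
/-- An endo-trivial digraph on at least three vertices has no endomorphism with exactly two
values. -/
theorem EndoTrivial.not_isDigraphHom_ite {V : Type*} [Fintype V] {E : V → V → Prop}
    (het : EndoTrivial E) (hcard : 3 ≤ Fintype.card V) (p : V → Prop) {a b x y : V}
    (hab : a ≠ b) (hx : p x) (hy : ¬ p y) :
    ¬ IsDigraphHom E E (fun z => if p z then a else b) := by
  intro hf
  rcases het _ hf with h | ⟨c, hc⟩
  · have hp : Function.Injective p := fun u v huv => h.injective (by simp only [huv])
    have := Fintype.card_le_of_injective p hp
    rw [Fintype.card_prop] at this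
    omega
  · have h₁ := hc x
    have h₂ := hc y
    simp only [hx, hy, if_true, if_false] at h₁ h₂
    exact hab (h₁.trans h₂.symm)

/-- A reflexive endo-trivial digraph on at least three vertices is antisymmetric. -/
theorem EndoTrivial.eq_of_adj_of_adj {V : Type*} [Fintype V] {E : V → V → Prop}
    (het : EndoTrivial E) (hcard : 3 ≤ Fintype.card V) (hrefl : ∀ v, E v v) {a b : V}
    (hab : E a b) (hba : E b a) : a = b := by
  classical
  by_contra hne
  refine het.not_isDigraphHom_ite hcard (· = a) hne rfl (Ne.symm hne) fun u v _ => ?_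
  dsimp only
  split_ifs <;> first | assumption | exact hrefl _

theorem EndoTrivial.exists_not_adj_right {V : Type*} [Fintype V] {E : V → V → Prop}
    (het : EndoTrivial E) (hcard : 3 ≤ Fintype.card V) (hrefl : ∀ v, E v v) (c : V) :
    ∃ z, ¬ E z c := by
  classical
  by_contra! hc
  have : Nontrivial V := Fintype.one_lt_card_iff_nontrivial.mp (by omega)
  obtain ⟨d, hd⟩ := exists_ne c
  refine het.not_isDigraphHom_ite hcard (· = c) hd.symm rfl hd fun u v huv => ?_
  dsimp only
  split_ifs with hu hv
  · exact hrefl c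
  · subst hu
    exact absurd (het.eq_of_adj_of_adj hcard hrefl (hc v) huv) hv
  · exact hc d
  · exact hrefl d

theorem EndoTrivial.exists_not_adj_left {V : Type*} [Fintype V] {E : V → V → Prop}
    (het : EndoTrivial E) (hcard : 3 ≤ Fintype.card V) (hrefl : ∀ v, E v v) (c : V) :
    ∃ z, ¬ E c z := by
  classical
  by_contra! hc
  have : Nontrivial V := Fintype.one_lt_card_iff_nontrivial.mp (by omega)
  obtain ⟨d, hd⟩ := exists_ne c
  refine het.not_isDigraphHom_ite hcard (· = c) hd.symm rfl hd fun u v huv => ?_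
  dsimp only
  split_ifs with hu hv hv
  · exact hrefl c
  · exact hc d
  · subst hv
    exact absurd (het.eq_of_adj_of_adj hcard hrefl huv (hc u)) hu
  · exact hrefl d

/-- If an injective endomorphism `h` of a finite reflexive digraph is an out-neighbour of the
identity in the self-map digraph, then `h x` is adjacent to `x` in both directions. -/
theorem SelfMapAdj.adj_symm_of_injective {V : Type*} [Finite V] {E : V → V → Prop}
    (hrefl : ∀ v, E v v) {h : V → V} (hh : IsDigraphHom E E h) (hinj : Function.Injective h)
    (hadj : SelfMapAdj E id h) (x : V) : E x (h x) ∧ E (h x) x := by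
  refine ⟨hadj x x (hrefl x), ?_⟩
  let k : {y // E x y} → {y // E x y} := fun y => ⟨h y, hadj x y y.2⟩
  have hk : Function.Injective k := fun y z hyz => Subtype.ext (hinj (congrArg Subtype.val hyz))
  obtain ⟨⟨z, hxz⟩, hz⟩ := Finite.surjective_of_injective hk ⟨x, hrefl x⟩
  have hzx : h z = x := congrArg Subtype.val hz
  simpa only [hzx] using hh x z hxz

/-- For an endo-trivial reflexive digraph `H` with at least three vertices, the endomorphism
digraph `Ĥ^H` is the disjoint union of a copy of `H` on the constant maps together with
isolated vertices on the automorphisms: (i) constant maps `c_u, c_v` are adjacent iff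
`(u,v) ∈ E(H)`; (ii) any edge between two distinct endomorphisms joins two constant maps. -/
theorem stmt7 {V : Type*} [Fintype V] (E : V → V → Prop)
    (hcard : 3 ≤ Fintype.card V)
    (hrefl : ∀ v, E v v)
    (het : EndoTrivial E) :
    (∀ u v : V, SelfMapAdj E (fun _ => u) (fun _ => v) ↔ E u v) ∧
      (∀ f g : V → V, IsDigraphHom E E f → IsDigraphHom E E g → f ≠ g →
        SelfMapAdj E f g → IsConstMap f ∧ IsConstMap g) := by
  refine ⟨fun u v => ⟨fun h => h u u (hrefl u), fun h _ _ _ => h⟩, fun f g hf hg hne hfg => ?_⟩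
  rcases het f hf with hfa | ⟨c, hc⟩ <;> rcases het g hg with hga | ⟨d, hd⟩
  · obtain ⟨-, f', hf'f, hff', hf'⟩ := hfa
    refine absurd (funext fun x => ?_) hne
    have hadj : SelfMapAdj E id (f' ∘ g) := fun x y hxy => by
      simpa only [hf'f, id, Function.comp_apply] using hf' _ _ (hfg x y hxy)
    have hinj : Function.Injective (f' ∘ g) :=
      (Function.LeftInverse.injective hff').comp hga.injective
    obtain ⟨h₁, h₂⟩ := hadj.adj_symm_of_injective hrefl
      (fun u v huv => hf' _ _ (hg u v huv)) hinj x
    have hx : x = f' (g x) := het.eq_of_adj_of_adj hcard hrefl h₁ h₂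
    exact (congrArg f hx).trans (hff' (g x))
  · obtain ⟨-, f', -, hff', -⟩ := hfa
    obtain ⟨z, hz⟩ := het.exists_not_adj_right hcard hrefl d
    refine absurd ?_ hz
    simpa only [hff', hd] using hfg (f' z) (f' z) (hrefl _)
  · obtain ⟨-, g', -, hgg', -⟩ := hga
    obtain ⟨z, hz⟩ := het.exists_not_adj_left hcard hrefl c
    refine absurd ?_ hz
    simpa only [hgg', hc] using hfg (g' z) (g' z) (hrefl _)
  · exact ⟨⟨c, hc⟩, ⟨d, hd⟩⟩
end

section
/- Let H be an endo-trivial reflexive tournament with at least three vertices. Then H contains a directed Hamilton cycle. -/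
/-- In an endo-trivial reflexive tournament on at least three vertices, every nonempty proper
set of vertices has an outgoing edge. -/
theorem EndoTrivial.exists_edge_leaving {V : Type*} [Fintype V] {E : V → V → Prop}
    (hcard : 3 ≤ Fintype.card V) (hrefl : ∀ v, E v v)
    (htour : ∀ u v : V, u ≠ v → (E u v ↔ ¬ E v u)) (het : EndoTrivial E)
    {S : Set V} {s t : V} (hs : s ∈ S) (ht : t ∉ S) :
    ∃ u ∈ S, ∃ v ∉ S, E u v := by
  classical
  by_contra! h
  have hne : s ≠ t := fun hst => ht (hst ▸ hs)
  have hts : E t s := by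
    have := htour t s hne.symm
    exact this.2 (h s hs t ht)
  have hhom : IsDigraphHom E E (fun x => if x ∈ S then s else t) := by
    intro u v huv
    by_cases hu : u ∈ S <;> by_cases hv : v ∈ S <;> simp only [hu, hv, if_true, if_false]
    · exact hrefl s
    · exact absurd huv (h u hu v hv)
    · exact hts
    · exact hrefl t
  rcases het _ hhom with ⟨_, g, hg, _, _⟩ | ⟨c, hc⟩
  · have hsub : (Finset.univ : Finset V) ⊆ {g s, g t} := by
      intro x _
      have := hg x
      by_cases hx : x ∈ S <;> simp only [hx, if_true, if_false] at this <;> simp [this]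
    have := (Finset.card_le_card hsub).trans Finset.card_le_two
    rw [Finset.card_univ] at this
    omega
  · have h1 := hc s
    have h2 := hc t
    simp only [hs, ht, if_true, if_false] at h1 h2
    exact hne (h1.trans h2.symm)

/-- If `P` holds at the head of a list but fails somewhere in it, then it holds at some entry and
fails at the next one. -/
theorem List.exists_append_cons_cons_of_head {α : Type*} {P : α → Prop} :
    ∀ (l : List α) (a : α), P a → (∃ y ∈ l, ¬ P y) →
      ∃ l₁ x y l₂, a :: l = l₁ ++ x :: y :: l₂ ∧ P x ∧ ¬ P y
  | [], _, _, h => by simp at h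
  | b :: l, a, ha, h => by
    by_cases hb : P b
    · obtain ⟨y, hy, hPy⟩ := h
      have hyl : y ∈ l := by
        rcases List.mem_cons.1 hy with rfl | hy
        · exact absurd hb hPy
        · exact hy
      obtain ⟨l₁, x, z, l₂, he, hx, hz⟩ :=
        List.exists_append_cons_cons_of_head l b hb ⟨y, hyl, hPy⟩
      exact ⟨a :: l₁, x, z, l₂, by rw [he]; rfl, hx, hz⟩
    · exact ⟨[], a, b, l, rfl, ha, hb⟩

theorem List.exists_isRotated_cons_of_mem {α : Type*} {a : α} {l : List α} (h : a ∈ l) :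
    ∃ l', l ~r a :: l' := by
  obtain ⟨s, t, rfl⟩ := List.append_of_mem h
  exact ⟨t ++ s, by simpa using (List.isRotated_append (l := s) (l' := a :: t))⟩

/-- The chain condition of a cycle through a consecutive pair `x, y`, cut open at that pair. -/
theorem Cycle.chain_append_cons_cons {α : Type*} {r : α → α → Prop} (l₁ l₂ : List α) (x y : α) :
    Cycle.Chain r (l₁ ++ x :: y :: l₂ : List α) ↔
      r x y ∧ List.IsChain r (y :: (l₂ ++ l₁ ++ [x])) := by
  have h : ((l₁ ++ x :: y :: l₂ : List α) : Cycle α) = (x :: y :: (l₂ ++ l₁) : List α) :=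
    Cycle.coe_eq_coe.2 (by simpa using (List.isRotated_append (l := l₁) (l' := x :: y :: l₂)))
  rw [h, Cycle.chain_coe_cons]
  simp

/-- A vertex outside a cycle that can not be inserted and receives an edge from the cycle receives
an edge from every vertex of the cycle. -/
theorem Cycle.Chain.edge_of_not_insertable {V : Type*} {E : V → V → Prop}
    (htour : ∀ u v : V, u ≠ v → (E u v ↔ ¬ E v u)) {l : List V}
    (hch : Cycle.Chain E (l : Cycle V)) (hnd : l.Nodup)
    (hmax : ∀ l' : List V, Cycle.Chain E (l' : Cycle V) → l'.Nodup → l'.length ≤ l.length)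
    {a v : V} (hv : v ∉ l) (ha : a ∈ l) (hav : E a v) : ∀ y ∈ l, E y v := by
  by_contra! hy
  obtain ⟨y, hyl, hyv⟩ := hy
  obtain ⟨m, hm⟩ := List.exists_isRotated_cons_of_mem ha
  have hym : y ∈ m := by
    rcases List.mem_cons.1 (hm.mem_iff.1 hyl) with rfl | h
    · exact absurd hav hyv
    · exact h
  obtain ⟨l₁, x, z, l₂, he, hx, hz⟩ :=
    List.exists_append_cons_cons_of_head (P := fun u => E u v) m a hav ⟨y, hym, hyv⟩
  rw [he] at hm
  rw [Cycle.coe_eq_coe.2 hm, Cycle.chain_append_cons_cons] at hch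
  have hzl : z ∈ l := hm.mem_iff.2 (by simp)
  have hvz : E v z := (htour v z (fun h => hv (h ▸ hzl))).2 hz
  have hnd' := hm.nodup_iff.1 hnd
  have hv' : v ∉ l₁ ++ x :: z :: l₂ := fun h => hv (hm.mem_iff.2 h)
  have hlen := hmax (l₁ ++ x :: v :: z :: l₂)
    ((Cycle.chain_append_cons_cons _ _ _ _).2 ⟨hx, by
      simpa using ⟨hvz, by simpa using hch.2⟩⟩)
    (by
      have hp : (l₁ ++ x :: v :: z :: l₂).Perm (v :: (l₁ ++ x :: z :: l₂)) := by
        simpa using (List.perm_middle (a := v) (l₁ := l₁ ++ [x]) (l₂ := z :: l₂))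
      exact hp.nodup_iff.2 (List.nodup_cons.2 ⟨hv', hnd'⟩))
  have := hm.perm.length_eq
  simp at this hlen
  omega

/-- In a strongly connected reflexive tournament, a longest cycle visits every vertex. -/
theorem Cycle.Chain.mem_of_length_max {V : Type*} {E : V → V → Prop}
    (htour : ∀ u v : V, u ≠ v → (E u v ↔ ¬ E v u))
    (hstrong : ∀ (S : Set V) (s t : V), s ∈ S → t ∉ S → ∃ u ∈ S, ∃ v ∉ S, E u v)
    {l : List V} (hne : l ≠ [])
    (hch : Cycle.Chain E (l : Cycle V)) (hnd : l.Nodup)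
    (hmax : ∀ l' : List V, Cycle.Chain E (l' : Cycle V) → l'.Nodup → l'.length ≤ l.length)
    (w : V) : w ∈ l := by
  by_contra hw
  obtain ⟨c, m, rfl⟩ := List.exists_cons_of_ne_nil hne
  have hall := fun {a v : V} => hch.edge_of_not_insertable htour hnd hmax (a := a) (v := v)
  obtain ⟨d, hd, e, he, hde⟩ := hstrong {x | x ∈ c :: m} c w (by simp) hw
  obtain ⟨a, ⟨ha, hca⟩, b, hb, hab⟩ :=
    hstrong {x | x ∉ c :: m ∧ E c x} e c ⟨he, hall he hd hde c (by simp)⟩ (by simp)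
  have hbl : b ∉ c :: m := fun hbl =>
    (htour a b (fun h => ha (h ▸ hbl))).1 hab (hall ha (by simp) hca b hbl)
  have hcb : ¬ E c b := fun h => hb ⟨hbl, h⟩
  have hnab : a ≠ b := fun h => hcb (h ▸ hca)
  have hbm : ∀ y ∈ c :: m, E b y := fun y hy =>
    (htour b y (fun h => hbl (h ▸ hy))).2 fun hyb => hcb (hall hbl hy hyb c (by simp))
  have hlen := hmax (c :: a :: b :: m) (by
      rw [Cycle.chain_coe_cons] at hch ⊢
      refine List.IsChain.cons_cons hca (List.IsChain.cons_cons hab ?_)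
      cases m with
      | nil => simpa using hbm c (by simp)
      | cons y m => exact List.IsChain.cons_cons (hbm y (by simp)) hch.tail)
    (by
      simp only [List.nodup_cons, List.mem_cons, not_or] at *
      tauto)
  simp at hlen

/-- A cyclic list that enumerates a finite type gives an enumeration by `ZMod`. -/
theorem Cycle.Chain.exists_bijective_zmod {V : Type*} [Fintype V] {E : V → V → Prop} {l : List V}
    (hne : l ≠ []) (hch : Cycle.Chain E (l : Cycle V)) (hnd : l.Nodup) (hmem : ∀ v, v ∈ l) :
    ∃ v : ZMod (Fintype.card V) → V, Function.Bijective v ∧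
      ∀ i : ZMod (Fintype.card V), E (v i) (v (i + 1)) := by
  classical
  have hlen : l.length = Fintype.card V := by
    rw [← List.toFinset_card_of_nodup hnd, ← Finset.card_univ]
    congr 1
    ext x
    simp [hmem x]
  rw [← hlen]
  obtain ⟨c, m, rfl⟩ := List.exists_cons_of_ne_nil hne
  -- `ZMod (k + 1)` is `Fin (k + 1)` by definition
  change ∃ v : Fin (m.length + 1) → V, Function.Bijective v ∧ ∀ i, E (v i) (v (i + 1))
  refine ⟨fun i => (c :: m).get i, ⟨List.nodup_iff_injective_get.1 hnd, fun v =>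
    List.mem_iff_get.1 (hmem v)⟩, fun i => ?_⟩
  rw [Cycle.chain_coe_cons, ← List.cons_append, List.isChain_iff_getElem] at hch
  have h := hch i.1 (by simpa using i.is_le)
  rw [List.getElem_append_left i.2] at h
  induction i using Fin.lastCases with
  | last => simpa using h
  | cast i =>
    rw [List.getElem_append_left (by simp)] at h
    simpa using h

/-- An endo-trivial reflexive tournament with at least three vertices contains a directed
Hamilton cycle: a cyclic enumeration of all vertices, each exactly once, following edges. -/
theorem stmt8 {V : Type*} [Fintype V] (E : V → V → Prop)
    (hcard : 3 ≤ Fintype.card V)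
    (hrefl : ∀ v, E v v)
    (htour : ∀ u v : V, u ≠ v → (E u v ↔ ¬ E v u))
    (het : EndoTrivial E) :
    ∃ v : ZMod (Fintype.card V) → V, Function.Bijective v ∧
      ∀ i : ZMod (Fintype.card V), E (v i) (v (i + 1)) := by
  have hstrong : ∀ (S : Set V) (s t : V), s ∈ S → t ∉ S → ∃ u ∈ S, ∃ v ∉ S, E u v :=
    fun _ _ _ => het.exists_edge_leaving hcard hrefl htour
  let Q : ℕ → Prop := fun k => ∃ l : List V, Cycle.Chain E (l : Cycle V) ∧ l.Nodup ∧ l.length = k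
  have hbound : ∀ k, Q k → k ≤ Fintype.card V := by
    rintro _ ⟨l, -, hnd, rfl⟩
    exact hnd.length_le_card
  classical
  obtain ⟨v⟩ : Nonempty V := Fintype.card_pos_iff.1 (by omega)
  have hQ : Q 1 := ⟨[v], by simpa using hrefl v, by simp, rfl⟩
  obtain ⟨l, hch, hnd, hl⟩ := Nat.findGreatest_spec (hbound 1 hQ) hQ
  have hmax : ∀ l' : List V, Cycle.Chain E (l' : Cycle V) → l'.Nodup → l'.length ≤ l.length :=
    fun l' h₁ h₂ => hl ▸ Nat.le_findGreatest (hbound _ ⟨l', h₁, h₂, rfl⟩) ⟨l', h₁, h₂, rfl⟩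
  have hne : l ≠ [] := by
    rintro rfl
    simpa using hmax [v] (by simpa using hrefl v) (by simp)
  exact hch.exists_bijective_zmod hne hnd (hch.mem_of_length_max htour hstrong hne hnd hmax)
end

section
/- Let H be an endo-trivial reflexive tournament and let H' be a homomorphic image of H with 1 < |V(H')| < |V(H)|. Then H' possesses a double edge: there are distinct vertices u, v of H' with both (u,v) ∈ E(H') and (v,u) ∈ E(H'). -/
/-- Any homomorphic image, of size strictly between `1` and `|V(H)|`, of an endo-trivial
reflexive tournament `H` possesses a double edge. -/
theorem stmt9 {V V' : Type*} [Fintype V] [Fintype V'] [Nontrivial V]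
    (E : V → V → Prop) (E' : V' → V' → Prop)
    (hrefl : ∀ v, E v v)
    (htour : ∀ u v : V, u ≠ v → (E u v ↔ ¬ E v u))
    (het : EndoTrivial E)
    (h : V → V')
    (hhom : IsDigraphHom E E' h)
    (hvsurj : Function.Surjective h)
    (hesurj : ∀ x' y' : V', E' x' y' → ∃ x y : V, E x y ∧ h x = x' ∧ h y = y')
    (hlow : 1 < Fintype.card V') (hhigh : Fintype.card V' < Fintype.card V) :
    ∃ u v : V', u ≠ v ∧ E' u v ∧ E' v u := by
  by_contra! hno
  obtain ⟨s, hs⟩ := hvsurj.hasRightInverse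
  have hend : IsDigraphHom E E (s ∘ h) := by
    intro u v huv
    by_cases huv' : h u = h v
    · simpa [huv'] using hrefl _
    · refine (htour _ _ (hs.injective.ne huv')).2 fun hvu ↦ hno _ _ huv' (hhom _ _ huv) ?_
      simpa [hs _] using hhom _ _ hvu
  rcases het _ hend with ⟨-, g, hg, -, -⟩ | ⟨c, hc⟩
  · have hinj : Function.Injective (s ∘ h) := Function.LeftInverse.injective hg
    exact absurd (Fintype.card_le_of_injective h hinj.of_comp) (not_le.2 hhigh)
  · obtain ⟨a, b, hab⟩ := Fintype.exists_pair_of_one_lt_card hlow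
    have hsc : ∀ x, s x = c := fun x ↦ by simpa [hs x] using hc (s x)
    exact hab (hs.injective ((hsc a).trans (hsc b).symm))
end

section
/- Let m ≥ 3, let T be a reflexive tournament, and let h be a homomorphism from the gadget Cyl_m to T. If h is constant on the bottom copy of DC*_m (i.e., |h({(i,0) : i ∈ Z_m})| = 1), then h is constant on all of Cyl_m (|h(V(Cyl_m))| = 1). -/
/-- Adjacency in the gadget `Cyl_m`: vertices are pairs `(i, j)` with `i ∈ ZMod m` a position
and `j ∈ Fin m` the index of the copy of the reflexive directed `m`-cycle. There is a
self-loop at every vertex, the cycle edges `(i,j) → (i+1,j)` inside each copy, the edges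
`(i,j) → (i,j+1)` going up one copy, and the edges `(i,j+1) → (i+1,j)` coming back down. -/
def CylAdj (m : ℕ) (p q : ZMod m × Fin m) : Prop :=
  p = q ∨
    (q.2 = p.2 ∧ q.1 = p.1 + 1) ∨
    ((q.2 : ℕ) = (p.2 : ℕ) + 1 ∧ q.1 = p.1) ∨
    ((p.2 : ℕ) = (q.2 : ℕ) + 1 ∧ q.1 = p.1 + 1)

/-- If a homomorphism from `Cyl_m` to a reflexive tournament is constant on the bottom copy
of the reflexive directed `m`-cycle, then it is constant on all of `Cyl_m`. -/
theorem stmt10 {W : Type*} [Fintype W] [Nontrivial W] (m : ℕ) (hm : 3 ≤ m)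
    (E : W → W → Prop)
    (hrefl : ∀ v, E v v)
    (htour : ∀ u v : W, u ≠ v → (E u v ↔ ¬ E v u))
    (h : ZMod m × Fin m → W)
    (hhom : ∀ p q, CylAdj m p q → E (h p) (h q))
    (hbot : ∃ c : W, ∀ i : ZMod m, h (i, (⟨0, by omega⟩ : Fin m)) = c) :
    ∃ c : W, ∀ p : ZMod m × Fin m, h p = c := by
  obtain ⟨c, hc⟩ := hbot
  have eq_of_edges : ∀ u v : W, E u v → E v u → v = u := fun u v huv hvu => by
    by_contra hne
    exact (htour v u hne).1 hvu huv
  have hcopy : ∀ (j : ℕ) (hj : j < m) (i : ZMod m), h (i, ⟨j, hj⟩) = c := by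
    intro j
    induction j with
    | zero => exact fun _ i => hc i
    | succ j ih =>
      intro hj i
      have hup := hhom (i, ⟨j, by omega⟩) (i, ⟨j + 1, hj⟩) (by simp [CylAdj])
      have hdown := hhom (i, ⟨j + 1, hj⟩) (i + 1, ⟨j, by omega⟩) (by simp [CylAdj])
      rw [ih] at hup hdown
      exact eq_of_edges _ _ hup hdown
  exact ⟨c, fun p => hcopy p.2 p.2.isLt p.1⟩
end

section
/- Let m ≥ 3. The retractions of the gadget Cyl_m onto its bottom copy of DC*_m induce on the top copy precisely the automorphisms (rotations) of DC*_m: (a) for every homomorphism r from Cyl_m to itself whose image is the bottom copy {(i,0) : i ∈ Z_m} and which fixes the bottom copy pointwise, there exists k ∈ Z_m such that r(i, m−1) = (i+k, 0) for all i ∈ Z_m; and (b) conversely, for every k ∈ Z_m there exists such a retraction r with r(i, m−1) = (i+k, 0) for all i ∈ Z_m. -/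
/-- Along an edge between vertices of the same copy the position moves by `0` or `1`. -/
theorem CylAdj.fst_eq_or_eq_add_one {m : ℕ} {p q : ZMod m × Fin m} (h : CylAdj m p q)
    (hpq : p.2 = q.2) : q.1 = p.1 ∨ q.1 = p.1 + 1 := by
  have hv : (p.2 : ℕ) = q.2 := congrArg Fin.val hpq
  rcases h with h | h | h | h
  · exact Or.inl (by rw [h])
  · exact Or.inr h.2
  · exact Or.inl h.2
  · exact Or.inr h.2

/-- A predicate on `ZMod m` that holds somewhere and is stable under `+ 1` holds everywhere. -/
theorem ZMod.forall_of_add_one {m : ℕ} [NeZero m] {P : ZMod m → Prop}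
    (hP : ∀ i, P i → P (i + 1)) {a : ZMod m} (ha : P a) (i : ZMod m) : P i := by
  have key : ∀ n : ℕ, P (a + n) := by
    intro n
    induction n with
    | zero => simpa using ha
    | succ n ih => simpa [add_assoc] using hP _ ih
  simpa using key (i - a).val

/-- An endomorphism of the reflexive directed `m`-cycle that is pointwise a rotation by `c` or by
`c + 1` is one of these two rotations. -/
theorem ZMod.eq_rotation_or {m : ℕ} (hm : 3 ≤ m) {g : ZMod m → ZMod m} {c : ZMod m}
    (hg : ∀ i, g (i + 1) = g i ∨ g (i + 1) = g i + 1)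
    (hc : ∀ i, g i = i + c ∨ g i = i + c + 1) :
    (∀ i, g i = i + c) ∨ ∀ i, g i = i + (c + 1) := by
  have : NeZero m := ⟨by omega⟩
  have : Fact (1 < m) := ⟨by omega⟩
  have h1 : (1 : ZMod m) ≠ 0 := one_ne_zero
  have h2 : (1 + 1 : ZMod m) ≠ 0 := by
    intro h
    have h' : ((2 : ℕ) : ZMod m) = 0 := by
      push_cast
      rw [← h]
      norm_num
    rw [ZMod.natCast_eq_zero_iff] at h'
    have := Nat.le_of_dvd (by norm_num) h'
    omega
  by_cases h : ∃ a, g a = a + c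
  · obtain ⟨a, ha⟩ := h
    refine Or.inl (ZMod.forall_of_add_one (fun i hi => ?_) ha)
    rcases hc (i + 1) with h | h
    · exact h
    · exfalso
      rcases hg i with h' | h'
      · exact h2 (by linear_combination h' - h + hi)
      · exact h1 (by linear_combination h' - h + hi)
  · push Not at h
    exact Or.inr fun i => by rw [← add_assoc]; exact (hc i).resolve_left (h i)

/-- The retractions of `Cyl_m` onto its bottom copy of the reflexive directed `m`-cycle
induce on the top copy precisely the rotations of the cycle:
(a) every retraction onto the bottom copy acts on the top copy as a rotation by some
`k ∈ ZMod m`; and (b) every rotation `k ∈ ZMod m` is realised by such a retraction. -/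
theorem stmt11 (m : ℕ) (hm : 3 ≤ m) :
    (∀ r : ZMod m × Fin m → ZMod m × Fin m,
        (∀ p q, CylAdj m p q → CylAdj m (r p) (r q)) →
        (∀ p : ZMod m × Fin m, (r p).2 = (⟨0, by omega⟩ : Fin m)) →
        (∀ i : ZMod m, r (i, (⟨0, by omega⟩ : Fin m)) = (i, (⟨0, by omega⟩ : Fin m))) →
        ∃ k : ZMod m, ∀ i : ZMod m,
          r (i, (⟨m - 1, by omega⟩ : Fin m)) = (i + k, (⟨0, by omega⟩ : Fin m))) ∧
      (∀ k : ZMod m, ∃ r : ZMod m × Fin m → ZMod m × Fin m,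
        (∀ p q, CylAdj m p q → CylAdj m (r p) (r q)) ∧
        (∀ p : ZMod m × Fin m, (r p).2 = (⟨0, by omega⟩ : Fin m)) ∧
        (∀ i : ZMod m, r (i, (⟨0, by omega⟩ : Fin m)) = (i, (⟨0, by omega⟩ : Fin m))) ∧
        (∀ i : ZMod m,
          r (i, (⟨m - 1, by omega⟩ : Fin m)) = (i + k, (⟨0, by omega⟩ : Fin m)))) := by
  have : NeZero m := ⟨by omega⟩
  constructor
  · intro r hr hr0 hfix
    have step : ∀ p q, CylAdj m p q → (r q).1 = (r p).1 ∨ (r q).1 = (r p).1 + 1 :=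
      fun p q h => (hr p q h).fst_eq_or_eq_add_one ((hr0 p).trans (hr0 q).symm)
    have key : ∀ (j : ℕ) (hj : j < m), ∃ c : ZMod m, ∀ i : ZMod m, (r (i, ⟨j, hj⟩)).1 = i + c := by
      intro j
      induction j with
      | zero => exact fun _ => ⟨0, fun i => by rw [hfix i, add_zero]⟩
      | succ j ih =>
        intro hj
        obtain ⟨c, hc⟩ := ih (by omega)
        have hrot := ZMod.eq_rotation_or hm (g := fun i => (r (i, ⟨j + 1, hj⟩)).1) (c := c)
          (fun i => step _ _ (Or.inr (Or.inl ⟨rfl, rfl⟩)))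
          (fun i => by
            have h := step (i, ⟨j, by omega⟩) (i, ⟨j + 1, hj⟩) (Or.inr (Or.inr (Or.inl ⟨rfl, rfl⟩)))
            rwa [hc i] at h)
        exact hrot.elim (fun h => ⟨c, h⟩) (fun h => ⟨c + 1, h⟩)
    obtain ⟨k, hk⟩ := key (m - 1) (by omega)
    exact ⟨k, fun i => Prod.ext (hk i) (hr0 _)⟩
  · intro k
    refine ⟨fun p => (p.1 + ((min (p.2 : ℕ) k.val : ℕ) : ZMod m), ⟨0, by omega⟩),
      ?_, fun _ => rfl, fun i => by simp, fun i => ?_⟩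
    · rintro ⟨a, s⟩ ⟨b, t⟩ (h | ⟨h, h'⟩ | ⟨h, h'⟩ | ⟨h, h'⟩)
      · exact Or.inl (by rw [h])
      · dsimp only at h h'
        subst h h'
        exact Or.inr (Or.inl ⟨rfl, by dsimp only; ring⟩)
      · dsimp only at h h'
        subst h'
        rcases le_or_gt k.val (s : ℕ) with hk | hk
        · left
          dsimp only
          rw [h, min_eq_right hk, min_eq_right (by omega)]
        · right; left
          refine ⟨rfl, ?_⟩
          dsimp only
          rw [h, min_eq_left hk.le, min_eq_left (by omega)]
          push_cast
          ring
      · dsimp only at h h'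
        subst h'
        rcases le_or_gt k.val (t : ℕ) with hk | hk
        · right; left
          refine ⟨rfl, ?_⟩
          dsimp only
          rw [h, min_eq_right hk, min_eq_right (by omega)]
          ring
        · left
          dsimp only
          rw [h, min_eq_left hk.le, min_eq_left (by omega)]
          push_cast
          congr 1
          ring
    · have := k.val_lt
      dsimp only
      rw [min_eq_right (by omega), ZMod.natCast_zmod_val]
end

section
/- Let H be a reflexive tournament that retracts to a subtournament H_0 on m ≥ 3 vertices having a directed Hamilton cycle HC_0 (i.e., there is an endomorphism of H with image V(H_0) that is the identity on V(H_0)). Then Spill_m(H[H_0,HC_0]) = V(H): for every vertex y of H there is a retraction r of F(H_0,HC_0) to H and a vertex x of the top copy of DC*_m in Cyl_m with r(x) = y. -/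
/-- The embedding of the gadget `Cyl_m` into the vertex set of `F(H_0,HC_0)`, which is
obtained from the disjoint union of `H` (with vertex set `V`) and `Cyl_m` by identifying
the vertex `(i,0)` of the bottom copy with the vertex `c i` of the Hamilton cycle `HC_0`
(given by `c : ZMod m → V`) of `H_0` in `H`. -/
def FEmb {V : Type*} (m : ℕ) (c : ZMod m → V) (p : ZMod m × Fin m) :
    V ⊕ (ZMod m × Fin m) :=
  if (p.2 : ℕ) = 0 then Sum.inl (c p.1) else Sum.inr p

/-- The edge relation of the digraph `F(H_0,HC_0)`: the edges of `H` together with the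
images of the edges of `Cyl_m` under the identification of its bottom copy with `HC_0`. -/
def FAdj {V : Type*} (m : ℕ) (E : V → V → Prop) (c : ZMod m → V)
    (a b : V ⊕ (ZMod m × Fin m)) : Prop :=
  (∃ u v : V, E u v ∧ a = Sum.inl u ∧ b = Sum.inl v) ∨
    (∃ p q : ZMod m × Fin m, CylAdj m p q ∧ a = FEmb m c p ∧ b = FEmb m c q)

/-- If the cycle `D` may sit on top of the bottom copy `c` of the gadget, then sending every copy
but the bottom one to `D` is a retraction of `F(H_0,HC_0)`. -/
theorem exists_retraction_of_cycle {V : Type*} {m : ℕ} (hm : 2 ≤ m) {E : V → V → Prop}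
    (hrefl : ∀ v, E v v) {c D : ZMod m → V} (hc : ∀ i, E (c i) (c (i + 1)))
    (hD : ∀ i, E (D i) (D (i + 1))) (hcD : ∀ i, E (c i) (D i)) (hDc : ∀ i, E (D i) (c (i + 1)))
    (i₀ : ZMod m) (j₀ : Fin m) (hj₀ : (j₀ : ℕ) = m - 1) :
    ∃ r : V ⊕ (ZMod m × Fin m) → V,
      (∀ u : V, r (Sum.inl u) = u) ∧
      (∀ a b : V ⊕ (ZMod m × Fin m), FAdj m E c a b → E (r a) (r b)) ∧
      (∃ i : ZMod m, r (FEmb m c (i, j₀)) = D i₀) := by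
  have hemb (p : ZMod m × Fin m) : Sum.elim id (fun q => D q.1) (FEmb m c p) =
      if (p.2 : ℕ) = 0 then c p.1 else D p.1 := by
    unfold FEmb
    split_ifs <;> rfl
  refine ⟨Sum.elim id fun q => D q.1, fun _ => rfl, ?_, i₀, ?_⟩
  · rintro a b (⟨u, v, huv, rfl, rfl⟩ | ⟨p, q, hpq, rfl, rfl⟩)
    · exact huv
    · rw [hemb, hemb]
      obtain ⟨i, j⟩ := p
      obtain ⟨i', j'⟩ := q
      dsimp only [CylAdj] at hpq ⊢
      rcases hpq with h | ⟨rfl, rfl⟩ | ⟨hj, rfl⟩ | ⟨hj, rfl⟩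
      · cases h
        exact hrefl _
      all_goals
        split_ifs <;> first | omega | apply_assumption
  · rw [hemb, if_neg (by dsimp only; omega)]

/-- Replacing a vertex of a closed walk `c` by a vertex `y` adjacent to its two neighbours gives
another closed walk. -/
theorem update_adj_update {V : Type*} {m : ℕ} (hm : 2 ≤ m) {E : V → V → Prop} {c : ZMod m → V}
    (hc : ∀ i, E (c i) (c (i + 1))) {k : ZMod m} {y : V} (hin : E (c (k - 1)) y)
    (hout : E y (c (k + 1))) (i : ZMod m) :
    E (Function.update c k y i) (Function.update c k y (i + 1)) := by
  have : Fact (1 < m) := ⟨hm⟩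
  by_cases hi : i = k
  · subst hi
    simpa [Function.update_apply] using hout
  · by_cases hi' : i + 1 = k
    · obtain rfl : i = k - 1 := eq_sub_of_add_eq hi'
      simpa [Function.update_apply] using hin
    · simpa [Function.update_apply, hi, hi'] using hc i

/-- If a reflexive tournament `H` retracts to a subtournament `H_0` on `m ≥ 3` vertices
carrying a directed Hamilton cycle `HC_0` (given by `c : ZMod m → V`), then
`Spill_m(H[H_0,HC_0]) = V(H)`: for every vertex `y` of `H` there is a retraction `r` of
`F(H_0,HC_0)` to `H` mapping some vertex of the top copy of the directed `m`-cycle to `y`. -/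
theorem stmt12 {V : Type*} [Fintype V] (m : ℕ) (hm : 3 ≤ m)
    (E : V → V → Prop)
    (hrefl : ∀ v, E v v)
    (htour : ∀ u v : V, u ≠ v → (E u v ↔ ¬ E v u))
    (c : ZMod m → V) (hcinj : Function.Injective c)
    (hham : ∀ i : ZMod m, E (c i) (c (i + 1)))
    (ret : V → V)
    (hrethom : ∀ u v : V, E u v → E (ret u) (ret v))
    (hretid : ∀ i : ZMod m, ret (c i) = c i)
    (hretim : ∀ v : V, ∃ i : ZMod m, ret v = c i) :
    ∀ y : V, ∃ r : V ⊕ (ZMod m × Fin m) → V,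
      (∀ u : V, r (Sum.inl u) = u) ∧
      (∀ a b : V ⊕ (ZMod m × Fin m), FAdj m E c a b → E (r a) (r b)) ∧
      (∃ i : ZMod m, r (FEmb m c (i, (⟨m - 1, by omega⟩ : Fin m))) = y) := by
  intro y
  have : Fact (1 < m) := ⟨by omega⟩
  obtain ⟨k, hk⟩ := hretim y
  have htotal (u v : V) (h : ¬ E u v) : E v u :=
    (htour v u fun e => h (e ▸ hrefl _)).2 h
  have hasymm (i : ZMod m) : ¬ E (c (i + 1)) (c i) :=
    (htour _ _ (hcinj.ne (by simp))).1 (hham i)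
  have hout : E y (c (k + 1)) := by
    by_contra h
    have := hrethom _ _ (htotal _ _ h)
    rw [hretid, hk] at this
    exact hasymm k this
  have hin : E (c (k - 1)) y := by
    by_contra h
    have := hrethom _ _ (htotal _ _ h)
    rw [hretid, hk] at this
    exact hasymm (k - 1) (by simpa using this)
  have hwalk := update_adj_update (by omega) hham hin hout
  by_cases hky : E (c k) y
  · obtain ⟨r, hr, hr', hr''⟩ := exists_retraction_of_cycle (by omega) hrefl hham hwalk
      (fun i => by
        by_cases hi : i = k
        · subst hi; simpa using hky
        · simpa [hi] using hrefl _)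
      (fun i => by
        by_cases hi : i = k
        · subst hi; simpa using hout
        · simpa [hi] using hham i) k ⟨m - 1, by omega⟩ rfl
    exact ⟨r, hr, hr', by simpa using hr''⟩
  · obtain ⟨r, hr, hr', hr''⟩ := exists_retraction_of_cycle (by omega) hrefl hham
      (D := fun i => Function.update c k y (i + 1)) (fun i => hwalk (i + 1))
      (fun i => by
        by_cases hi : i + 1 = k
        · obtain rfl : i = k - 1 := eq_sub_of_add_eq hi
          simpa using hin
        · simpa [hi] using hham i)
      (fun i => by
        by_cases hi : i + 1 = k
        · subst hi; simpa using htotal _ _ hky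
        · simpa [hi] using hrefl _) (k - 1) ⟨m - 1, by omega⟩ rfl
    exact ⟨r, hr, hr', by simpa using hr''⟩
end

section
/- Let H be a reflexive tournament and let H_0 be the subtournament induced on a subset S of V(H). Suppose that every endomorphism e of H that fixes H_0 (i.e., with e(S) = S) is an automorphism of H. Then every endomorphism h of H that maps H_0 isomorphically onto an induced subtournament of H (equivalently, every endomorphism h that is injective on S) is an automorphism of H. -/
/-- A section, defined on the range of `h`, of an endomorphism `h` of a reflexive tournament
preserves edges. -/
theorem edge_section_of_isDigraphHom {V : Type*} {E : V → V → Prop}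
    (hrefl : ∀ v, E v v) (htour : ∀ u v : V, u ≠ v → (E u v ↔ ¬ E v u))
    {h s : V → V} (hhom : IsDigraphHom E E h) {a b : V} (ha : h (s a) = a) (hb : h (s b) = b)
    (hab : E a b) : E (s a) (s b) := by
  by_cases hs : s a = s b
  · rw [hs]
    exact hrefl _
  · rw [htour _ _ hs]
    intro hba
    have hne : a ≠ b := fun heq => hs (by rw [heq])
    have hE := hhom _ _ hba
    rw [ha, hb] at hE
    exact (htour a b hne).1 hab hE

/-- Let `H` be a reflexive tournament and `H_0` the subtournament induced on `S ⊆ V(H)`.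
If every endomorphism of `H` fixing `H_0` (i.e. with `e(S) = S`) is an automorphism of `H`,
then every endomorphism of `H` that maps `H_0` isomorphically onto an induced subtournament
(equivalently, that is injective on `S`) is an automorphism of `H`. -/
theorem stmt13 {V : Type*} [Fintype V] [Nontrivial V] (E : V → V → Prop)
    (hrefl : ∀ v, E v v)
    (htour : ∀ u v : V, u ≠ v → (E u v ↔ ¬ E v u))
    (S : Set V)
    (hfix : ∀ e : V → V, IsDigraphHom E E e → e '' S = S → IsDigraphAuto E e)
    (h : V → V) (hhom : IsDigraphHom E E h)
    (hinj : Set.InjOn h S) :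
    IsDigraphAuto E h := by
  classical
  obtain ⟨s, hs, hsS⟩ : ∃ s : V → V, (∀ x, h (s (h x)) = h x) ∧ ∀ x ∈ S, s (h x) = x := by
    refine ⟨fun v => if v ∈ h '' S then Function.invFunOn h S v else Function.invFun h v, ?_, ?_⟩
    · intro x
      dsimp only
      split_ifs with hx
      · exact Function.invFunOn_eq hx
      · exact Function.invFun_eq ⟨x, rfl⟩
    · intro x hx
      have hmem : h x ∈ h '' S := Set.mem_image_of_mem h hx
      simp only [hmem, if_true]
      exact hinj (Function.invFunOn_mem hmem) hx (Function.invFunOn_eq hmem)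
  obtain ⟨-, g, hg, -, -⟩ := hfix (fun x => s (h x))
    (fun u v huv => edge_section_of_isDigraphHom hrefl htour hhom (hs u) (hs v) (hhom u v huv))
    (by rw [Set.image_congr hsS, Set.image_id'])
  have hinj' : Function.Injective h := fun x y hxy => by
    simpa only [hg] using congrArg (fun z => g (s z)) hxy
  let e := Equiv.ofBijective h (Finite.injective_iff_bijective.1 hinj')
  exact ⟨hhom, e.symm, e.symm_apply_apply, e.apply_symm_apply, fun u v huv =>
    edge_section_of_isDigraphHom hrefl htour hhom (e.apply_symm_apply u) (e.apply_symm_apply v) huv⟩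
end

section
/- Let H_2 ⊇ H_1 ⊇ H_0 be strongly connected reflexive tournaments, each an induced subtournament of the next, on vertex sets S_2 ⊇ S_1 ⊇ S_0. Suppose that every endomorphism of H_1 that fixes H_0 (i.e., maps S_0 onto S_0) is an automorphism of H_1. Then every endomorphism h of H_2 that maps H_0 isomorphically onto an induced subtournament (equivalently, is injective on S_0) is injective on S_1, i.e., h maps H_1 isomorphically onto the subtournament of H_2 induced on h(S_1). -/
/-- A map injective on `S ⊆ T` has a section over `h '' T` with values in `T` that inverts `h`
on `S`. -/
theorem Set.InjOn.exists_section_extending {α β : Type*} [Nonempty α] {h : α → β} {S T : Set α}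
    (hST : S ⊆ T) (hS : Set.InjOn h S) :
    ∃ g : β → α, (∀ x ∈ T, g (h x) ∈ T ∧ h (g (h x)) = h x) ∧ ∀ x ∈ S, g (h x) = x := by
  classical
  refine ⟨fun y => if y ∈ h '' S then Function.invFunOn h S y else Function.invFunOn h T y,
    fun x hx => ?_, fun x hx => ?_⟩
  · by_cases hy : h x ∈ h '' S
    · simp only [hy, if_true]
      exact ⟨hST (Function.invFunOn_mem hy), Function.invFunOn_eq hy⟩
    · simp only [hy, if_false]
      exact ⟨Function.invFunOn_mem ⟨x, hx, rfl⟩, Function.invFunOn_eq ⟨x, hx, rfl⟩⟩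
  · simp only [Set.mem_image_of_mem h hx, if_true]
    exact hS.leftInvOn_invFunOn hx

/-- The fibers of a homomorphism between tournaments are homogeneous: an edge between vertices of
two distinct fibers transfers to any other vertices of these fibers. -/
theorem IsDigraphHom.adj_of_adj {V W : Type*} {E : V → V → Prop} {F : W → W → Prop} {h : V → W}
    (hE : ∀ u v : V, u ≠ v → (E u v ↔ ¬ E v u)) (hF : ∀ u v : W, u ≠ v → (F u v ↔ ¬ F v u))
    (hhom : IsDigraphHom E F h) {a b a' b' : V} (ha : h a' = h a) (hb : h b' = h b)
    (hne : h a ≠ h b) (hab : E a b) : E a' b' := by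
  have hne' : a' ≠ b' := fun heq => hne (by rw [← ha, ← hb, heq])
  refine (hE a' b' hne').2 fun hba => (hF _ _ hne).1 (hhom a b hab) ?_
  simpa only [ha, hb] using hhom b' a' hba

/-- Let `H_2 ⊇ H_1 ⊇ H_0` be strongly connected reflexive tournaments, where `H_2` has
vertex set `V` and edge relation `E`, and `H_1`, `H_0` are the subtournaments induced on
`S_1 ⊇ S_0`. If every endomorphism of `H_1` fixing `H_0` (mapping `S_0` onto `S_0`) is an
automorphism of `H_1`, then every endomorphism `h` of `H_2` that maps `H_0` isomorphically
onto an induced subtournament (equivalently, is injective on `S_0`) is injective on `S_1`,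
i.e. maps `H_1` isomorphically onto the subtournament induced on `h(S_1)`. -/
theorem stmt14 {V : Type*} [Fintype V] [Nontrivial V] (E : V → V → Prop)
    (S0 S1 : Set V) (h01 : S0 ⊆ S1)
    (hS0nt : S0.Nontrivial) (hS1nt : S1.Nontrivial)
    (hrefl : ∀ v, E v v)
    (htour : ∀ u v : V, u ≠ v → (E u v ↔ ¬ E v u))
    (hsc2 : ∀ u v : V, Relation.ReflTransGen E u v)
    (hsc1 : ∀ u v : S1, Relation.ReflTransGen (fun a b : S1 => E a.1 b.1) u v)
    (hsc0 : ∀ u v : S0, Relation.ReflTransGen (fun a b : S0 => E a.1 b.1) u v)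
    (hfix : ∀ e : S1 → S1,
        IsDigraphHom (fun a b : S1 => E a.1 b.1) (fun a b : S1 => E a.1 b.1) e →
        (Subtype.val '' (e '' {x : S1 | (x : V) ∈ S0}) = S0) →
        IsDigraphAuto (fun a b : S1 => E a.1 b.1) e)
    (h : V → V) (hhom : IsDigraphHom E E h)
    (hinj0 : Set.InjOn h S0) :
    Set.InjOn h S1 := by
  obtain ⟨g, hg, hg0⟩ := hinj0.exists_section_extending h01
  let e : S1 → S1 := fun x => ⟨g (h x), (hg x x.2).1⟩
  have he : IsDigraphHom (fun a b : S1 => E a.1 b.1) (fun a b : S1 => E a.1 b.1) e := by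
    intro a b hab
    by_cases heq : h a = h b
    · have hee : e a = e b := Subtype.ext (congrArg g heq)
      rw [hee]
      exact hrefl _
    · exact hhom.adj_of_adj htour htour (hg a a.2).2 (hg b b.2).2 heq hab
  have he0 : Subtype.val '' (e '' {x : S1 | (x : V) ∈ S0}) = S0 := by
    ext v
    constructor
    · rintro ⟨_, ⟨x, hx, rfl⟩, rfl⟩
      exact Set.mem_of_eq_of_mem (hg0 x hx) hx
    · exact fun hv => ⟨_, ⟨⟨v, h01 hv⟩, hv, rfl⟩, hg0 v hv⟩
  obtain ⟨-, f, hf, -⟩ := hfix e he he0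
  intro x hx y hy hxy
  have hee : e ⟨x, hx⟩ = e ⟨y, hy⟩ := Subtype.ext (congrArg g hxy)
  have := congrArg f hee
  rw [hf, hf] at this
  exact congrArg Subtype.val this
end

section
/- Let F be the digraph on vertex set {0,1,2} with edge set {(1,1),(2,2),(0,1),(1,2),(2,0)} (the directed 3-cycle 0→1→2→0 with self-loops at 1 and 2 but not at 0). Then every polymorphism of F, of every arity, is essentially unary. -/
/-- The digraph on `{0,1,2}` with edge set `{(1,1),(2,2),(0,1),(1,2),(2,0)}`:
the directed 3-cycle `0 → 1 → 2 → 0` with self-loops at `1` and `2` but not at `0`. -/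
def FAdj3 (a b : Fin 3) : Prop :=
  (a, b) = (1, 1) ∨ (a, b) = (2, 2) ∨ (a, b) = (0, 1) ∨ (a, b) = (1, 2) ∨ (a, b) = (2, 0)

instance : DecidableRel FAdj3 := fun a b => by unfold FAdj3; infer_instance

namespace FAdj3

/-- The vertex tuple with entry `2` on `S` and entry the other loop vertex `1` off `S`. -/
def loopTuple {ι : Type*} [DecidableEq ι] (S : Finset ι) (j : ι) : Fin 3 :=
  if j ∈ S then 2 else 1

theorem eq_one_or_eq_two_of_loop : ∀ {a : Fin 3}, FAdj3 a a → a = 1 ∨ a = 2 := by decide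

theorem eq_zero_of_two_of_one : ∀ {a : Fin 3}, FAdj3 2 a → FAdj3 a 1 → a = 0 := by decide

theorem eq_one_of_one_of_one : ∀ {a : Fin 3}, FAdj3 1 a → FAdj3 a 1 → a = 1 := by decide

theorem eq_two_of_two_of_two : ∀ {a : Fin 3}, FAdj3 2 a → FAdj3 a 2 → a = 2 := by decide

theorem loopTuple_left {ι : Type*} [DecidableEq ι] {S : Finset ι} {x : ι → Fin 3}
    (h0 : ∀ j, x j = 0 → j ∈ S) (h1 : ∀ j, x j = 1 → j ∉ S) (j : ι) :
    FAdj3 (loopTuple S j) (x j) := by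
  have key : ∀ (a : Fin 3) (p : Bool), (a = 0 → p = true) → (a = 1 → p = false) →
      FAdj3 (if p then 2 else 1) a := by decide
  simpa [loopTuple] using key (x j) (decide (j ∈ S)) (by simpa using h0 j) (by simpa using h1 j)

theorem loopTuple_right {ι : Type*} [DecidableEq ι] {S : Finset ι} {x : ι → Fin 3}
    (h2 : ∀ j, x j = 2 → j ∈ S) (h0 : ∀ j, x j = 0 → j ∉ S) (j : ι) :
    FAdj3 (x j) (loopTuple S j) := by
  have key : ∀ (a : Fin 3) (p : Bool), (a = 2 → p = true) → (a = 0 → p = false) →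
      FAdj3 a (if p then 2 else 1) := by decide
  simpa [loopTuple] using key (x j) (decide (j ∈ S)) (by simpa using h2 j) (by simpa using h0 j)

section Polymorphism

variable {ι : Type*} [DecidableEq ι] {f : (ι → Fin 3) → Fin 3}
  (hf : ∀ x y : ι → Fin 3, (∀ i, FAdj3 (x i) (y i)) → FAdj3 (f x) (f y))

include hf

theorem map_loopTuple_eq (S : Finset ι) : f (loopTuple S) = 1 ∨ f (loopTuple S) = 2 := by
  refine eq_one_or_eq_two_of_loop (hf _ _ fun j => ?_)
  unfold loopTuple
  split_ifs <;> decide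

theorem map_loopTuple_mono {S T : Finset ι} (hST : S ⊆ T) :
    FAdj3 (f (loopTuple S)) (f (loopTuple T)) := by
  refine hf _ _ (loopTuple_right (fun j hj => hST ?_) fun j hj => ?_)
  · by_contra h
    simp [loopTuple, h] at hj
  · unfold loopTuple at hj
    split_ifs at hj <;> simp at hj

theorem map_loopTuple_eq_two_of_subset {S T : Finset ι} (hST : S ⊆ T)
    (hS : f (loopTuple S) = 2) : f (loopTuple T) = 2 := by
  have h := map_loopTuple_mono hf hST
  rcases map_loopTuple_eq hf T with hT | hT
  · rw [hS, hT] at h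
    exact absurd h (by decide)
  · exact hT

theorem map_loopTuple_eq_one_of_subset {S T : Finset ι} (hST : S ⊆ T)
    (hT : f (loopTuple T) = 1) : f (loopTuple S) = 1 := by
  refine (map_loopTuple_eq hf S).resolve_right fun hS => ?_
  rw [map_loopTuple_eq_two_of_subset hf hST hS] at hT
  exact absurd hT (by decide)

variable [Fintype ι]

/-- A coordinate at which the value on loop tuples switches decides all values on loop tuples. -/
theorem map_loopTuple_of_switch {S : Finset ι} {a : ι} (ha : a ∉ S)
    (hS : f (loopTuple S) = 1) (haS : f (loopTuple (insert a S)) = 2) (T : Finset ι) :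
    f (loopTuple T) = loopTuple T a := by
  let x : ι → Fin 3 := fun j => if j = a then 0 else if j ∈ S then 2 else 1
  have h_left := hf _ _ (loopTuple_left (S := insert a S) (x := x) (by grind) (by grind))
  have h_right := hf _ _ (loopTuple_right (S := S) (x := x) (by grind) (by grind))
  have hx : f x = 0 := eq_zero_of_two_of_one (haS ▸ h_left) (hS ▸ h_right)
  have h_single : f (loopTuple {a}) = 2 := by
    have h := hf _ _ (loopTuple_left (S := {a}) (x := x) (by grind) (by grind))
    refine (map_loopTuple_eq hf _).resolve_left fun h' => ?_
    rw [hx, h'] at h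
    exact absurd h (by decide)
  have h_compl : f (loopTuple {a}ᶜ) = 1 := by
    have h := hf _ _ (loopTuple_right (S := {a}ᶜ) (x := x)
      (by grind [Finset.mem_compl]) (by grind [Finset.mem_compl]))
    refine (map_loopTuple_eq hf _).resolve_right fun h' => ?_
    rw [hx, h'] at h
    exact absurd h (by decide)
  by_cases haT : a ∈ T
  · simpa [loopTuple, haT] using
      map_loopTuple_eq_two_of_subset hf (Finset.singleton_subset_iff.2 haT) h_single
  · simpa [loopTuple, haT] using
      map_loopTuple_eq_one_of_subset hf (by simpa [Finset.subset_compl_comm] using haT) h_compl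

theorem exists_switch (h_empty : f (loopTuple ∅) = 1) (h_univ : f (loopTuple Finset.univ) = 2) :
    ∃ (S : Finset ι) (a : ι), a ∉ S ∧ f (loopTuple S) = 1 ∧ f (loopTuple (insert a S)) = 2 := by
  by_contra! h
  have h_one : ∀ S : Finset ι, f (loopTuple S) = 1 := fun S => by
    induction S using Finset.induction_on with
    | empty => exact h_empty
    | insert a S ha ih => exact (map_loopTuple_eq hf _).resolve_right (h S a ha ih)
  rw [h_one] at h_univ
  exact absurd h_univ (by decide)

theorem map_loopTuple_adj (x : ι → Fin 3) :
    FAdj3 (f (loopTuple {j | x j ≠ 1})) (f x) ∧ FAdj3 (f x) (f (loopTuple {j | x j = 2})) :=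
  ⟨hf _ _ (loopTuple_left (by simp +contextual) (by simp)),
    hf _ _ (loopTuple_right (by simp) (by simp +contextual))⟩

theorem eq_const_or_eq_eval :
    (∀ x, f x = 1) ∨ (∀ x, f x = 2) ∨ ∃ i, ∀ x, f x = x i := by
  rcases map_loopTuple_eq hf Finset.univ with h_univ | h_univ
  · refine Or.inl fun x => ?_
    have h := map_loopTuple_adj hf x
    simp only [map_loopTuple_eq_one_of_subset hf (Finset.subset_univ _) h_univ] at h
    exact eq_one_of_one_of_one h.1 h.2
  rcases map_loopTuple_eq hf ∅ with h_empty | h_empty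
  · obtain ⟨S, i, hi, hS, hiS⟩ := exists_switch hf h_empty h_univ
    refine Or.inr (Or.inr ⟨i, fun x => ?_⟩)
    have h := map_loopTuple_adj hf x
    simp only [map_loopTuple_of_switch hf hi hS hiS, loopTuple, Finset.mem_filter,
      Finset.mem_univ, true_and] at h
    have key : ∀ a b : Fin 3, FAdj3 (if b ≠ 1 then 2 else 1) a ∧
      FAdj3 a (if b = 2 then 2 else 1) → a = b := by decide
    exact key _ _ h
  · refine Or.inr (Or.inl fun x => ?_)
    have h := map_loopTuple_adj hf x
    simp only [map_loopTuple_eq_two_of_subset hf (Finset.empty_subset _) h_empty] at h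
    exact eq_two_of_two_of_two h.1 h.2

end Polymorphism

end FAdj3

/-- Every polymorphism of the digraph `FAdj3` is essentially unary. -/
theorem stmt15 (k : ℕ) (hk : 1 ≤ k)
    (f : (Fin k → Fin 3) → Fin 3)
    (hpoly : ∀ x y : Fin k → Fin 3, (∀ i, FAdj3 (x i) (y i)) → FAdj3 (f x) (f y)) :
    ∃ (i : Fin k) (g : Fin 3 → Fin 3), ∀ x : Fin k → Fin 3, f x = g (x i) := by
  rcases FAdj3.eq_const_or_eq_eval hpoly with h | h | ⟨i, h⟩
  · exact ⟨⟨0, hk⟩, fun _ => 1, h⟩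
  · exact ⟨⟨0, hk⟩, fun _ => 2, h⟩
  · exact ⟨i, id, h⟩
end
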